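/- Key counting claim of Section 2: for n ≥ 3 and every scattering channel C, the number of pairs (σ, T), where σ is a permutation of Fin n and T is a triangulation of the n-gon, such that ch(σ, T) = C, is exactly n · 2^{n−2}. (In the paper's phrasing: for any scattering channel S of the φ³ S-matrix, there are n·2^{n−2} elements of S_n that take some planar Feynman diagram to S.) -/

import Mathlib

/-- Normalization of a subset of `Fin n`: itself if it contains `0`, else its complement. -/
def normSet {n : ℕ} [NeZero n] (J : Finset (Fin n)) : Finset (Fin n) :=
  if (0 : Fin n) ∈ J then J else Jᶜ

/-- A split: a subset containing 0 with `2 ≤ |I| ≤ n - 2`. -/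
def IsSplit {n : ℕ} [NeZero n] (I : Finset (Fin n)) : Prop :=
  (0 : Fin n) ∈ I ∧ 2 ≤ I.card ∧ I.card ≤ n - 2

/-- Action of a permutation on a subset, followed by normalization. -/
def actSet {n : ℕ} [NeZero n] (σ : Equiv.Perm (Fin n)) (J : Finset (Fin n)) : Finset (Fin n) :=
  normSet (J.image σ)

/-- Compatibility of two splits. -/
def Compatible {n : ℕ} (I J : Finset (Fin n)) : Prop :=
  I ⊆ J ∨ J ⊆ I ∨ I ∪ J = Finset.univ

/-- A scattering channel: `n - 3` pairwise compatible splits. -/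
def IsChannel {n : ℕ} [NeZero n] (C : Finset (Finset (Fin n))) : Prop :=
  C.card = n - 3 ∧ (∀ I ∈ C, IsSplit I) ∧ ∀ I ∈ C, ∀ J ∈ C, I ≠ J → Compatible I J

/-- A diagonal of the `n`-gon: a pair `(i, j)` with `i + 2 ≤ j` and `(i,j) ≠ (0, n-1)`. -/
def IsDiagonal {n : ℕ} (d : Fin n × Fin n) : Prop :=
  d.1.val + 2 ≤ d.2.val ∧ ¬(d.1.val = 0 ∧ d.2.val = n - 1)

/-- Two diagonals cross. -/
def Cross {n : ℕ} (d e : Fin n × Fin n) : Prop :=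
  (d.1 < e.1 ∧ e.1 < d.2 ∧ d.2 < e.2) ∨ (e.1 < d.1 ∧ d.1 < e.2 ∧ e.2 < d.2)

/-- A triangulation: `n - 3` pairwise noncrossing diagonals. -/
def IsTriangulation {n : ℕ} (T : Finset (Fin n × Fin n)) : Prop :=
  T.card = n - 3 ∧ (∀ d ∈ T, IsDiagonal d) ∧ ∀ d ∈ T, ∀ e ∈ T, d ≠ e → ¬ Cross d e

/-- The arc of a diagonal `(i, j)`: the subset `{i, i+1, …, j-1}` of `Fin n`. -/
def arcOf {n : ℕ} (d : Fin n × Fin n) : Finset (Fin n) :=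
  Finset.univ.filter (fun k => d.1.val ≤ k.val ∧ k.val < d.2.val)

/-- The channel of a pair (permutation, triangulation):
`ch(σ, T) = { σ • arc(i,j) : (i,j) ∈ T }`. -/
def channelOf {n : ℕ} [NeZero n] (σ : Equiv.Perm (Fin n)) (T : Finset (Fin n × Fin n)) :
    Finset (Finset (Fin n)) :=
  T.image (fun d => actSet σ (arcOf d))

section LaminarFamilies

variable {α : Type*}

/-- A relation that is a strict linear order on `X` and relates no other elements. -/
structure IsStrictOrderOn (X : Finset α) (r : α → α → Prop) : Prop where
  left_mem : ∀ {x y}, r x y → x ∈ X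
  right_mem : ∀ {x y}, r x y → y ∈ X
  irrefl : ∀ x, ¬ r x x
  trans : ∀ {x y z}, r x y → r y z → r x z
  total : ∀ {x y}, x ∈ X → y ∈ X → x ≠ y → r x y ∨ r y x

/-- A set containing everything that lies between two of its elements. -/
def IsConvexFor (r : α → α → Prop) (A : Finset α) : Prop :=
  ∀ x ∈ A, ∀ y ∈ A, ∀ z, r x z → r z y → z ∈ A

/-- A family of subsets of `X` of size at least two, any two of which are nested or disjoint. -/
structure IsLaminar (X : Finset α) (F : Finset (Finset α)) : Prop where
  subset : ∀ A ∈ F, A ⊆ X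
  two_le : ∀ A ∈ F, 2 ≤ A.card
  nested : ∀ A ∈ F, ∀ B ∈ F, A ⊆ B ∨ B ⊆ A ∨ Disjoint A B

/-- The strict linear orders on `X` for which every member of `F` is convex. -/
def convexOrders (X : Finset α) (F : Finset (Finset α)) : Set (α → α → Prop) :=
  {r | IsStrictOrderOn X r ∧ ∀ A ∈ F, IsConvexFor r A}

variable {X : Finset α} {F : Finset (Finset α)} {A : Finset α} {a b : α}

theorem IsLaminar.subset_or_disjoint_of_minimal (hF : IsLaminar X F) (hA : A ∈ F)
    (hmin : ∀ B ∈ F, A.card ≤ B.card) {S : Finset α} (hS : S ∈ F) :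
    A ⊆ S ∨ Disjoint A S := by
  rcases hF.nested A hA S hS with h | h | h
  · exact Or.inl h
  · exact Or.inl (Finset.eq_of_subset_of_card_le h (hmin S hS)).ge
  · exact Or.inr h

variable [DecidableEq α]

/-- Contract the minimal member `A` of a family by removing one of its points. -/
theorem IsLaminar.contract (hF : IsLaminar X F) (hA : A ∈ F)
    (hmin : ∀ B ∈ F, A.card ≤ B.card) (hb : b ∈ A) :
    IsLaminar (X.erase b) ((F.erase A).image (·.erase b)) ∧
      ((F.erase A).image (·.erase b)).card + 1 = F.card := by
  have key : ∀ S ∈ F.erase A, b ∈ S → A ⊂ S := by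
    intro S hS hbS
    rw [Finset.mem_erase] at hS
    rcases hF.subset_or_disjoint_of_minimal hA hmin hS.2 with h | h
    · exact h.ssubset_of_ne hS.1.symm
    · exact absurd hbS (Finset.disjoint_left.mp h hb)
  obtain ⟨a, ha, hab⟩ : ∃ a ∈ A, a ≠ b := by
    have := hF.two_le A hA
    exact Finset.exists_mem_ne (by omega) b
  have key' : ∀ S ∈ F.erase A, a ∈ S → b ∈ S := by
    intro S hS haS
    rw [Finset.mem_erase] at hS
    rcases hF.subset_or_disjoint_of_minimal hA hmin hS.2 with h | h
    · exact h hb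
    · exact absurd haS (Finset.disjoint_left.mp h ha)
  refine ⟨⟨?_, ?_, ?_⟩, ?_⟩
  · simp only [Finset.forall_mem_image]
    intro S hS
    exact Finset.erase_subset_erase b (hF.subset S (Finset.mem_of_mem_erase hS))
  · simp only [Finset.forall_mem_image]
    intro S hS
    by_cases hbS : b ∈ S
    · have h1 := Finset.card_lt_card (key S hS hbS)
      have h2 := hF.two_le A hA
      rw [Finset.card_erase_of_mem hbS]
      omega
    · rw [Finset.erase_eq_of_notMem hbS]
      exact hF.two_le S (Finset.mem_of_mem_erase hS)
  · simp only [Finset.forall_mem_image]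
    intro S hS T hT
    rcases hF.nested S (Finset.mem_of_mem_erase hS) T (Finset.mem_of_mem_erase hT) with h | h | h
    · exact Or.inl (Finset.erase_subset_erase b h)
    · exact Or.inr (Or.inl (Finset.erase_subset_erase b h))
    · exact Or.inr (Or.inr (h.mono (Finset.erase_subset _ _) (Finset.erase_subset _ _)))
  · rw [Finset.card_image_of_injOn, Finset.card_erase_add_one hA]
    intro S hS T hT hST
    have hiff : b ∈ S ↔ b ∈ T := by
      have h : a ∈ S.erase b ↔ a ∈ T.erase b := by
        simp only at hST
        rw [hST]
      simp only [Finset.mem_erase, hab, ne_eq, not_false_eq_true, true_and] at h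
      exact ⟨fun hs => key' T hT (h.1 ((key S hS hs).subset ha)),
        fun ht => key' S hS (h.2 ((key T hT ht).subset ha))⟩
    ext x
    have h := Finset.ext_iff.mp hST x
    simp only [Finset.mem_erase] at h
    by_cases hx : x = b
    · rw [hx]; exact hiff
    · simpa [hx] using h

theorem IsLaminar.card_lt (hF : IsLaminar X F) (hX : X.Nonempty) : F.card < X.card := by
  induction hk : F.card generalizing X F with
  | zero => exact hX.card_pos
  | succ k ih =>
    obtain ⟨A, hA, hmin⟩ := F.exists_min_image Finset.card (Finset.card_pos.mp (by omega))
    have h2 := hF.two_le A hA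
    obtain ⟨b, hb⟩ := Finset.card_pos.mp (show 0 < A.card by omega)
    have hbX := hF.subset A hA hb
    have hAX := Finset.card_le_card (hF.subset A hA)
    obtain ⟨h, hc⟩ := hF.contract hA hmin hb
    have hX' := Finset.card_erase_of_mem hbX
    have := ih h (Finset.card_pos.mp (by omega)) (by omega)
    omega

theorem IsLaminar.card_eq_two_of_minimal (hF : IsLaminar X F) (hcard : F.card + 1 = X.card)
    (hA : A ∈ F) (hmin : ∀ B ∈ F, A.card ≤ B.card) : A.card = 2 := by
  by_contra hne
  have h2 := hF.two_le A hA
  obtain ⟨P, hPA, hP⟩ := Finset.exists_subset_card_eq h2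
  have hPF : P ∉ F := fun h => by
    have := hmin P h
    omega
  have hnest : ∀ S ∈ F, P ⊆ S ∨ Disjoint P S := fun S hS =>
    (hF.subset_or_disjoint_of_minimal hA hmin hS).imp hPA.trans (Disjoint.mono_left hPA)
  have hlam : IsLaminar X (insert P F) := by
    refine ⟨?_, ?_, ?_⟩
    · simp only [Finset.forall_mem_insert]
      exact ⟨hPA.trans (hF.subset A hA), hF.subset⟩
    · simp only [Finset.forall_mem_insert]
      exact ⟨hP.ge, hF.two_le⟩
    · simp only [Finset.forall_mem_insert]
      refine ⟨⟨Or.inl subset_rfl, fun S hS => ?_⟩, fun S hS => ⟨?_, hF.nested S hS⟩⟩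
      · rcases hnest S hS with h | h
        exacts [Or.inl h, Or.inr (Or.inr h)]
      · rcases hnest S hS with h | h
        exacts [Or.inr (Or.inl h), Or.inr (Or.inr h.symm)]
  have := hlam.card_lt (Finset.card_pos.mp (by omega))
  rw [Finset.card_insert_of_notMem hPF] at this
  omega

/-- Removing `b` from an order in which `a` and `b` are adjacent loses only their relative order. -/
theorem ncard_convexOrders_contract [Finite α] (hab : a ≠ b) (ha : a ∈ X) (hb : b ∈ X)
    (hA : {a, b} ∈ F) (hiff : ∀ S ∈ F, a ∈ S ↔ b ∈ S) :
    (convexOrders X F).ncard =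
      (convexOrders (X.erase b) ((F.erase {a, b}).image (·.erase b))).ncard * 2 := by
  have hbij : Set.BijOn
      (fun r : α → α → Prop => ((fun x y => x ≠ b ∧ y ≠ b ∧ r x y : α → α → Prop), r a b))
      (convexOrders X F)
      (convexOrders (X.erase b) ((F.erase {a, b}).image (·.erase b)) ×ˢ
        (Set.univ : Set Prop)) := by
    refine ⟨?_, ?_, ?_⟩
    · rintro r ⟨hr, hcv⟩
      refine ⟨⟨⟨?_, ?_, ?_, ?_, ?_⟩, ?_⟩, trivial⟩
      · exact fun h => Finset.mem_erase.mpr ⟨h.1, hr.left_mem h.2.2⟩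
      · exact fun h => Finset.mem_erase.mpr ⟨h.2.1, hr.right_mem h.2.2⟩
      · exact fun x h => hr.irrefl x h.2.2
      · exact fun h h' => ⟨h.1, h'.2.1, hr.trans h.2.2 h'.2.2⟩
      · intro x y hx hy hxy
        rw [Finset.mem_erase] at hx hy
        exact (hr.total hx.2 hy.2 hxy).imp (fun h => ⟨hx.1, hy.1, h⟩) (fun h => ⟨hy.1, hx.1, h⟩)
      · simp only [Finset.forall_mem_image]
        intro S hS x hx y hy z hxz hzy
        exact Finset.mem_erase.mpr ⟨hzy.1, hcv S (Finset.mem_of_mem_erase hS) x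
          (Finset.mem_of_mem_erase hx) y (Finset.mem_of_mem_erase hy) z hxz.2.2 hzy.2.2⟩
    · have adj : ∀ r ∈ convexOrders X F, ∀ z, z ≠ a → z ≠ b →
          ((r z b ↔ r z a) ∧ (r b z ↔ r a z)) := by
        rintro r ⟨hr, hcv⟩ z hza hzb
        have h1 := hcv _ hA a (by simp) b (by simp) z
        have h2 := hcv _ hA b (by simp) a (by simp) z
        have hz : z ∉ ({a, b} : Finset α) := by simp [hza, hzb]
        refine ⟨⟨fun h => ?_, fun h => ?_⟩, ⟨fun h => ?_, fun h => ?_⟩⟩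
        · exact (hr.total (hr.left_mem h) ha hza).resolve_right fun h' => hz (h1 h' h)
        · exact (hr.total (hr.left_mem h) hb hzb).resolve_right fun h' => hz (h2 h' h)
        · exact (hr.total (hr.right_mem h) ha hza).resolve_left fun h' => hz (h2 h h')
        · exact (hr.total (hr.right_mem h) hb hzb).resolve_left fun h' => hz (h1 h h')
      intro r hr s hs hrs
      obtain ⟨h, hp⟩ := Prod.mk.injEq _ _ _ _ ▸ hrs
      have h' : ∀ x y, x ≠ b → y ≠ b → (r x y ↔ s x y) := fun x y hx hy => by
        have := congrFun₂ h x y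
        simpa [hx, hy] using this
      have hba : r b a ↔ s b a := by
        have flip : ∀ t, IsStrictOrderOn X t → (t b a ↔ ¬ t a b) := fun t ht =>
          ⟨fun h h' => ht.irrefl _ (ht.trans h h'), fun h => (ht.total ha hb hab).resolve_left h⟩
        rw [flip r hr.1, flip s hs.1, hp]
      funext x y
      refine propext ?_
      by_cases hx : x = b
      · subst hx
        by_cases hy : y = x
        · subst hy
          exact iff_of_false (hr.1.irrefl _) (hs.1.irrefl _)
        · by_cases hya : y = a
          · subst hya; exact hba
          · rw [(adj r hr y hya hy).2, (adj s hs y hya hy).2, h' _ _ hab hy]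
      · by_cases hy : y = b
        · subst hy
          by_cases hxa : x = a
          · subst hxa; exact iff_of_eq hp
          · rw [(adj r hr x hxa hx).1, (adj s hs x hxa hx).1, h' _ _ hx hab]
        · exact h' x y hx hy
    · rintro ⟨s, p⟩ ⟨⟨hs, hcv⟩, -⟩
      simp only [Finset.forall_mem_image] at hcv
      have hl := @hs.left_mem
      have hrm := @hs.right_mem
      have hi := hs.irrefl
      have ht := @hs.trans
      have hto := @hs.total
      simp only [Finset.mem_erase] at hl hrm hto
      obtain ⟨c, hcb, hcn⟩ : ∃ c : α → α, c b = a ∧ ∀ x, x ≠ b → c x = x :=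
        ⟨fun x => if x = b then a else x, if_pos rfl, fun x hx => if_neg hx⟩
      have hca : c a = a := hcn a hab
      have hcX : ∀ x ∈ X, c x ≠ b ∧ c x ∈ X := by
        intro x hx
        by_cases h : x = b
        · rw [h, hcb]; exact ⟨hab, ha⟩
        · rw [hcn x h]; exact ⟨h, hx⟩
      have hXc : ∀ x, c x ∈ X → x ∈ X := by
        intro x hx
        by_cases h : x = b
        · rw [h]; exact hb
        · rwa [hcn x h] at hx
      have hSc : ∀ S ∈ F, ∀ x, c x ∈ S ↔ x ∈ S := by
        intro S hS x
        by_cases h : x = b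
        · rw [h, hcb]; exact hiff S hS
        · rw [hcn x h]
      have hceq : ∀ x y, c x = c y → x = y ∨ (x = a ∧ y = b) ∨ (x = b ∧ y = a) := by
        intro x y h
        by_cases hx : x = b <;> by_cases hy : y = b <;> grind
      refine ⟨fun x y => s (c x) (c y) ∨ (p ∧ x = a ∧ y = b) ∨ (¬ p ∧ x = b ∧ y = a),
        ⟨⟨?_, ?_, ?_, ?_, ?_⟩, ?_⟩, ?_⟩
      · rintro x y (h | ⟨-, rfl, -⟩ | ⟨-, rfl, -⟩)
        exacts [hXc x (hl h).2, ha, hb]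
      · rintro x y (h | ⟨-, -, rfl⟩ | ⟨-, -, rfl⟩)
        exacts [hXc y (hrm h).2, hb, ha]
      · rintro x (h | ⟨-, h, h'⟩ | ⟨-, h, h'⟩)
        exacts [hi _ h, hab (h.symm.trans h'), hab (h'.symm.trans h)]
      · have hc : ∀ x y, (p ∧ x = a ∧ y = b) ∨ (¬ p ∧ x = b ∧ y = a) → c x = c y := by
          rintro x y (⟨-, rfl, rfl⟩ | ⟨-, rfl, rfl⟩) <;> rw [hca, hcb]
        rintro x y z (h | h) (h' | h')
        · exact Or.inl (ht h h')
        · exact Or.inl (hc y z h' ▸ h)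
        · exact Or.inl (hc x y h ▸ h')
        · clear hcv hs hi ht hl hrm hto hcX hXc hSc hceq
          grind
      · intro x y hx hy hxy
        by_cases h : c x = c y
        · clear hcv hs hi ht hl hrm hto hcX hXc hSc
          rcases hceq x y h with h | h | h <;> grind
        · rcases hto (hcX x hx) (hcX y hy) h with h | h
          · exact Or.inl (Or.inl h)
          · exact Or.inr (Or.inl h)
      · intro S hS x hx y hy z hxz hzy
        by_cases hSA : S = {a, b}
        · subst hSA
          have h1 : ∀ x ∈ ({a, b} : Finset α), c x = a := by
            simp [hca, hcb]
          simp only [h1 x hx, h1 y hy] at hxz hzy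
          rcases hxz with h | h
          · rcases hzy with h' | h'
            · exact absurd (ht h h') (hi a)
            · rcases h' with h' | h' <;> simp [h'.2.1]
          · rcases h with h | h <;> simp [h.2.2]
        · rcases hxz with h | h | h
          · rcases hzy with h' | h' | h'
            · have h1 := hcv (Finset.mem_erase.mpr ⟨hSA, hS⟩) (c x)
                (Finset.mem_erase.mpr ⟨(hl h).1, (hSc S hS x).2 hx⟩) (c y)
                (Finset.mem_erase.mpr ⟨(hrm h').1, (hSc S hS y).2 hy⟩) (c z) h h'
              exact (hSc S hS z).1 (Finset.mem_of_mem_erase h1)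
            · exact h'.2.1 ▸ (hiff S hS).2 (h'.2.2 ▸ hy)
            · exact h'.2.1 ▸ (hiff S hS).1 (h'.2.2 ▸ hy)
          · exact h.2.2 ▸ (hiff S hS).1 (h.2.1 ▸ hx)
          · exact h.2.2 ▸ (hiff S hS).2 (h.2.1 ▸ hx)
      · have h1 : ¬ s a a := hi a
        refine Prod.ext ?_ ?_
        · funext x y
          refine propext ⟨?_, fun h => ?_⟩
          · rintro ⟨hx, hy, h | h | h⟩
            · rwa [hcn x hx, hcn y hy] at h
            · exact absurd h.2.2 hy
            · exact absurd h.2.1 hx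
          · have hx := (hl h).1
            have hy := (hrm h).1
            exact ⟨hx, hy, Or.inl (by rwa [hcn x hx, hcn y hy])⟩
        · simp [hca, hcb, h1, hab]
  rw [← hbij.injOn.ncard_image, hbij.image_eq, Set.ncard_prod, Set.ncard_univ,
    Nat.card_eq_fintype_card, Fintype.card_prop]

theorem IsLaminar.ncard_convexOrders [Finite α] (hF : IsLaminar X F)
    (hcard : F.card + 1 = X.card) : (convexOrders X F).ncard = 2 ^ F.card := by
  induction hk : F.card generalizing X F with
  | zero =>
    obtain ⟨x, rfl⟩ := Finset.card_eq_one.mp (show X.card = 1 by omega)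
    obtain rfl := Finset.card_eq_zero.mp hk
    rw [pow_zero, Set.ncard_eq_one]
    refine ⟨fun _ _ => False, ?_⟩
    ext r
    rw [Set.mem_singleton_iff]
    constructor
    · rintro ⟨hr, -⟩
      funext y z
      refine eq_false fun h => ?_
      have hy := Finset.mem_singleton.mp (hr.left_mem h)
      have hz := Finset.mem_singleton.mp (hr.right_mem h)
      exact hr.irrefl x (by rwa [hy, hz] at h)
    · rintro rfl
      refine ⟨⟨?_, ?_, ?_, ?_, ?_⟩, ?_⟩ <;> simp +contextual
  | succ k ih =>
    obtain ⟨A, hA, hmin⟩ := F.exists_min_image Finset.card (Finset.card_pos.mp (by omega))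
    obtain ⟨a, b, hab, rfl⟩ :=
      Finset.card_eq_two.mp (hF.card_eq_two_of_minimal hcard hA hmin)
    have hX := hF.subset _ hA
    have ha : a ∈ X := hX (by simp)
    have hb : b ∈ X := hX (by simp)
    obtain ⟨h, hc⟩ := hF.contract hA hmin (show b ∈ ({a, b} : Finset α) by simp)
    have hX' := Finset.card_erase_of_mem hb
    rw [ncard_convexOrders_contract hab ha hb hA, ih h (by omega) (by omega), pow_succ]
    intro S hS
    rcases hF.subset_or_disjoint_of_minimal hA hmin hS with h | h
    · exact iff_of_true (h (by simp)) (h (by simp))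
    · rw [Finset.disjoint_left] at h
      exact iff_of_false (h (by simp)) (h (by simp))

end LaminarFamilies

section Polygon

open Finset

/-- Read cyclically from position `k`, membership in `Q` alternates along four positions. -/
def HasAlternation {n : ℕ} [NeZero n] (k : Fin n) (Q : Finset (Fin n)) : Prop :=
  ∃ a b c d, a - k < b - k ∧ b - k < c - k ∧ c - k < d - k ∧
    (a ∈ Q ↔ c ∈ Q) ∧ (b ∈ Q ↔ d ∈ Q) ∧ ¬ (a ∈ Q ↔ b ∈ Q)

/-- The order in which `σ` places the nonzero labels, read cyclically from the label `0`. -/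
def cyclicOrder {n : ℕ} [NeZero n] (σ : Equiv.Perm (Fin n)) (x y : Fin n) : Prop :=
  x ≠ 0 ∧ y ≠ 0 ∧ σ.symm x - σ.symm 0 < σ.symm y - σ.symm 0

variable {n : ℕ}

theorem mem_arcOf {d : Fin n × Fin n} {k : Fin n} : k ∈ arcOf d ↔ d.1 ≤ k ∧ k < d.2 := by
  rw [arcOf, mem_filter]
  exact and_iff_right (mem_univ k)

theorem card_arcOf (d : Fin n × Fin n) : (arcOf d).card = d.2.val - d.1.val := by
  rw [← Fin.card_Ico]
  congr 1
  ext k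
  rw [mem_arcOf, mem_Ico]

theorem exists_perm_lt_iff {r : Fin n → Fin n → Prop} (hr : IsStrictOrderOn univ r) :
    ∃ e : Equiv.Perm (Fin n), ∀ x y, e x < e y ↔ r x y := by
  classical
  have hlt : ∀ x, (univ.filter (r · x)).card < n := fun x => by
    have h : univ.filter (r · x) ⊂ univ :=
      (ssubset_univ_iff).mpr fun h => hr.irrefl x (by simpa using h.ge (mem_univ x))
    simpa using card_lt_card h
  let f : Fin n → Fin n := fun x => ⟨(univ.filter (r · x)).card, hlt x⟩
  have hmono : ∀ x y, r x y → f x < f y := fun x y hxy => by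
    change (univ.filter (r · x)).card < (univ.filter (r · y)).card
    refine card_lt_card ((ssubset_iff_of_subset fun z hz => ?_).mpr ⟨x, ?_, ?_⟩)
    · simp only [mem_filter, mem_univ, true_and] at hz ⊢
      exact hr.trans hz hxy
    · simpa using hxy
    · simpa using hr.irrefl x
  have hiff : ∀ x y, f x < f y ↔ r x y := fun x y => by
    refine ⟨fun h => ?_, hmono x y⟩
    by_contra hxy
    rcases eq_or_ne x y with rfl | hne
    · exact lt_irrefl _ h
    · exact lt_asymm h (hmono y x ((hr.total (mem_univ x) (mem_univ y) hne).resolve_left hxy))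
  have hinj : Function.Injective f := fun x y hxy => by
    by_contra hne
    rcases hr.total (mem_univ x) (mem_univ y) hne with h | h
    · exact (hmono x y h).ne hxy
    · exact (hmono y x h).ne' hxy
  exact ⟨Equiv.ofBijective f (Finite.injective_iff_bijective.mp hinj), hiff⟩

theorem perm_eq_of_lt_iff_lt {e e' : Equiv.Perm (Fin n)}
    (h : ∀ x y, e x < e y ↔ e' x < e' y) : e = e' := by
  have hmono : StrictMono (e.symm.trans e') := fun x y hxy => by
    simpa using (h (e.symm x) (e.symm y)).mp (by simpa using hxy)
  have hid : e.symm.trans e' = Equiv.refl _ := by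
    have := Subsingleton.elim (hmono.orderIsoOfSurjective _ (Equiv.surjective _)) (OrderIso.refl _)
    ext x
    exact congrArg Fin.val (DFunLike.congr_fun this x)
  ext x
  have := DFunLike.congr_fun hid (e x)
  simpa using congrArg Fin.val this.symm

variable [NeZero n]

theorem HasAlternation.shift {k : Fin n} {Q : Finset (Fin n)} (h : HasAlternation k Q)
    (l : Fin n) : HasAlternation l Q := by
  obtain ⟨a, b, c, d, hab, hbc, hcd, hac, hbd, hne⟩ := h
  have hval : ∀ x y : Fin n,
      (y.val ≤ x.val ∧ (x - y).val = x.val - y.val) ∨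
        (x.val < y.val ∧ (x - y).val = n + x.val - y.val) := by
    intro x y
    rcases le_or_gt y x with h | h
    · exact Or.inl ⟨h, Fin.sub_val_of_le h⟩
    · exact Or.inr ⟨h, Fin.coe_sub_iff_lt.mpr h⟩
  have cyc : (a - l < b - l ∧ b - l < c - l ∧ c - l < d - l) ∨
      (b - l < c - l ∧ c - l < d - l ∧ d - l < a - l) ∨
      (c - l < d - l ∧ d - l < a - l ∧ a - l < b - l) ∨
      (d - l < a - l ∧ a - l < b - l ∧ b - l < c - l) := by
    have ha := hval (a - k) (l - k)
    have hb := hval (b - k) (l - k)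
    have hc := hval (c - k) (l - k)
    have hd := hval (d - k) (l - k)
    rw [sub_sub_sub_cancel_right] at ha hb hc hd
    have := (d - k).isLt
    have := (l - k).isLt
    simp only [Fin.lt_def] at *
    omega
  rcases cyc with ⟨h1, h2, h3⟩ | ⟨h1, h2, h3⟩ | ⟨h1, h2, h3⟩ | ⟨h1, h2, h3⟩
  · exact ⟨a, b, c, d, h1, h2, h3, hac, hbd, hne⟩
  · exact ⟨b, c, d, a, h1, h2, h3, hbd, hac.symm, by tauto⟩
  · exact ⟨c, d, a, b, h1, h2, h3, hac.symm, hbd.symm, by tauto⟩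
  · exact ⟨d, a, b, c, h1, h2, h3, hbd.symm, hac, by tauto⟩

theorem hasAlternation_compl {k : Fin n} {Q : Finset (Fin n)} :
    HasAlternation k Qᶜ ↔ HasAlternation k Q := by
  unfold HasAlternation
  simp only [Finset.mem_compl, not_iff_not]

theorem not_hasAlternation_arcOf (d : Fin n × Fin n) : ¬ HasAlternation 0 (arcOf d) := by
  rintro ⟨a, b, c, e, h⟩
  simp only [sub_zero, mem_arcOf, Fin.lt_def, Fin.le_def] at h
  omega

/-- A set of `2, …, n - 2` positions avoiding the last one and without alternation is an arc. -/
theorem exists_arcOf_eq {Q : Finset (Fin n)} (h2 : 2 ≤ Q.card) (hn : Q.card ≤ n - 2)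
    (hQ : ¬ HasAlternation 0 Q) {m : Fin n} (hm : m.val = n - 1) (hmQ : m ∉ Q) :
    ∃ d, IsDiagonal d ∧ arcOf d = Q := by
  have hne : Q.Nonempty := card_pos.mp (by omega)
  have hmax : (Q.max' hne).val + 1 < n := by
    have h1 : Q.max' hne ≠ m := fun h => hmQ (h ▸ Q.max'_mem hne)
    have h2 := (Q.max' hne).isLt
    rw [Ne, Fin.ext_iff] at h1
    omega
  have harc : arcOf (Q.min' hne, ⟨(Q.max' hne).val + 1, hmax⟩) = Q := by
    ext k
    rw [mem_arcOf]
    constructor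
    · rintro ⟨h1, h2⟩
      by_contra hk
      simp only [Fin.lt_def] at h2
      have hmin := Q.min'_mem hne
      have hmx := Q.max'_mem hne
      have hlt1 : Q.min' hne < k := lt_of_le_of_ne h1 fun h => hk (h ▸ hmin)
      have hlt2 : k < Q.max' hne :=
        lt_of_le_of_ne (Fin.le_def.mpr (by omega)) fun h => hk (h ▸ hmx)
      have hlt3 : Q.max' hne < m := Fin.lt_def.mpr (by omega)
      refine hQ ⟨Q.min' hne, k, Q.max' hne, m, ?_⟩
      simp [hlt1, hlt2, hlt3, hmin, hmx, hk, hmQ]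
    · intro hk
      have := Fin.le_def.mp (Q.le_max' k hk)
      exact ⟨Q.min'_le k hk, Fin.lt_def.mpr (by simp only; omega)⟩
  refine ⟨_, ?_, harc⟩
  have hc := card_arcOf (Q.min' hne, ⟨(Q.max' hne).val + 1, hmax⟩)
  rw [harc] at hc
  simp only at hc
  constructor
  · simp only
    omega
  · simp only
    omega

theorem exists_arcOf_eq_or_compl_iff {Q : Finset (Fin n)} (h2 : 2 ≤ Q.card)
    (hn : Q.card ≤ n - 2) :
    (∃ d, IsDiagonal d ∧ (arcOf d = Q ∨ arcOf d = Qᶜ)) ↔ ¬ HasAlternation 0 Q := by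
  constructor
  · rintro ⟨d, -, rfl | h⟩
    · exact not_hasAlternation_arcOf d
    · rw [← hasAlternation_compl, ← h]
      exact not_hasAlternation_arcOf d
  · intro hQ
    have hpos := NeZero.pos n
    have hm : (⟨n - 1, by omega⟩ : Fin n).val = n - 1 := rfl
    by_cases hmQ : (⟨n - 1, by omega⟩ : Fin n) ∈ Q
    · have hc : Qᶜ.card = n - Q.card := by rw [card_compl, Fintype.card_fin]
      obtain ⟨d, hd, h⟩ := exists_arcOf_eq (by omega) (by omega)
        (mt hasAlternation_compl.mp hQ) hm (by simpa using hmQ)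
      exact ⟨d, hd, Or.inr h⟩
    · obtain ⟨d, hd, h⟩ := exists_arcOf_eq h2 hn hQ hm hmQ
      exact ⟨d, hd, Or.inl h⟩

theorem isConvexFor_cyclicOrder_iff (σ : Equiv.Perm (Fin n)) {A : Finset (Fin n)}
    (hA : 0 ∉ A) :
    IsConvexFor (cyclicOrder σ) A ↔ ¬ HasAlternation 0 (A.image σ.symm) := by
  have hmem : ∀ p, p ∈ A.image σ.symm ↔ σ p ∈ A := fun p => by
    simp [Equiv.symm_apply_eq]
  have hpos : ∀ {p q : Fin n}, p - σ.symm 0 < q - σ.symm 0 → σ q ≠ 0 := by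
    intro p q h hq
    rw [← hq, σ.symm_apply_apply, sub_self] at h
    exact Fin.not_lt_zero _ h
  rw [← not_iff_not, not_not]
  constructor
  · intro h
    simp only [IsConvexFor, not_forall] at h
    obtain ⟨x, hx, y, hy, z, ⟨hx0, hz0, hxz⟩, ⟨-, hy0, hzy⟩, hz⟩ := h
    refine HasAlternation.shift (k := σ.symm 0)
      ⟨σ.symm 0, σ.symm x, σ.symm z, σ.symm y, ?_, hxz, hzy, ?_⟩ 0
    · rw [sub_self, Fin.pos_iff_ne_zero, sub_ne_zero]
      exact σ.symm.injective.ne hx0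
    · simp only [hmem, Equiv.apply_symm_apply]
      tauto
  · intro h hcv
    obtain ⟨a, b, c, d, hab, hbc, hcd, hac, hbd, hne⟩ := h.shift (σ.symm 0)
    simp only [hmem] at hac hbd hne
    have key : ∀ p q r, p - σ.symm 0 < q - σ.symm 0 → q - σ.symm 0 < r - σ.symm 0 →
        σ p ∈ A → σ r ∈ A → σ q ∈ A := fun p q r hpq hqr hp hr => by
      refine hcv _ hp _ hr _ ⟨?_, hpos hpq, by simpa using hpq⟩
        ⟨hpos hpq, hpos hqr, by simpa using hqr⟩
      rintro h
      exact hA (h ▸ hp)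
    by_cases ha : σ a ∈ A
    · exact hne (iff_of_true ha (key a b c hab hbc ha (hac.1 ha)))
    · have hb : σ b ∈ A := by tauto
      exact ha (hac.2 (key b c d hbc hcd hb (hbd.1 hb)))

theorem actSet_eq_iff (σ : Equiv.Perm (Fin n)) (J : Finset (Fin n)) {I : Finset (Fin n)}
    (hI : 0 ∈ I) :
    actSet σ J = I ↔ J = Iᶜ.image σ.symm ∨ J = (Iᶜ.image σ.symm)ᶜ := by
  have hmem : ∀ p, p ∈ Iᶜ.image σ.symm ↔ σ p ∉ I := fun p => by
    simp [Equiv.symm_apply_eq]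
  have himg : ∀ x, x ∈ J.image σ ↔ σ.symm x ∈ J := fun x => by
    simp [← Equiv.eq_symm_apply]
  have h1 : J = Iᶜ.image σ.symm ↔ J.image σ = Iᶜ := by
    simp only [Finset.ext_iff, hmem, himg, mem_compl]
    exact ⟨fun h x => by simpa using h (σ.symm x), fun h x => by simpa using h (σ x)⟩
  have h2 : J = (Iᶜ.image σ.symm)ᶜ ↔ J.image σ = I := by
    simp only [Finset.ext_iff, hmem, himg, mem_compl, not_not]
    exact ⟨fun h x => by simpa using h (σ.symm x), fun h x => by simpa using h (σ x)⟩
  rw [h1, h2, actSet, normSet]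
  split_ifs with h
  · refine ⟨Or.inr, fun h' => h'.resolve_left fun h'' => ?_⟩
    rw [h'', mem_compl] at h
    exact h hI
  · rw [compl_eq_comm, eq_comm]
    refine ⟨Or.inl, fun h' => h'.resolve_right fun h'' => ?_⟩
    rw [h''] at h
    exact h hI

theorem exists_actSet_arcOf_eq_iff (σ : Equiv.Perm (Fin n)) {I : Finset (Fin n)}
    (hI : IsSplit I) :
    (∃ d, IsDiagonal d ∧ actSet σ (arcOf d) = I) ↔ IsConvexFor (cyclicOrder σ) Iᶜ := by
  obtain ⟨h0, h2, hn⟩ := hI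
  have hc : (Iᶜ.image σ.symm).card = n - I.card := by
    rw [card_image_of_injective _ σ.symm.injective, card_compl, Fintype.card_fin]
  rw [isConvexFor_cyclicOrder_iff σ (by simpa using h0),
    ← exists_arcOf_eq_or_compl_iff (by omega) (by omega)]
  simp only [actSet_eq_iff σ _ h0]

theorem bijOn_cyclicOrder (C : Finset (Finset (Fin n))) :
    Set.BijOn (fun σ : Equiv.Perm (Fin n) => (σ.symm 0, cyclicOrder σ))
      {σ | ∀ I ∈ C, IsConvexFor (cyclicOrder σ) Iᶜ}
      (Set.univ ×ˢ convexOrders {0}ᶜ (insert {0}ᶜ (C.image compl))) := by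
  refine ⟨?_, ?_, ?_⟩
  · intro σ hσ
    refine ⟨trivial, ⟨?_, ?_, ?_, ?_, ?_⟩, ?_⟩
    · exact fun h => by simpa using h.1
    · exact fun h => by simpa using h.2.1
    · exact fun x h => lt_irrefl _ h.2.2
    · exact fun h h' => ⟨h.1, h'.2.1, h.2.2.trans h'.2.2⟩
    · intro x y hx hy hxy
      simp only [mem_compl, mem_singleton] at hx hy
      have hne : σ.symm x - σ.symm 0 ≠ σ.symm y - σ.symm 0 :=
        fun h => hxy (σ.symm.injective (sub_left_injective h))
      exact (lt_or_gt_of_ne hne).imp (fun h => ⟨hx, hy, h⟩) (fun h => ⟨hy, hx, h⟩)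
    · simp only [forall_mem_insert, forall_mem_image]
      exact ⟨fun x _ y _ z hxz _ => by simpa using hxz.2.1, hσ⟩
  · intro σ _ τ _ h
    obtain ⟨h0, hr⟩ := Prod.mk.injEq _ _ _ _ ▸ h
    have heq : σ.symm.trans (Equiv.subRight (σ.symm 0)) =
        τ.symm.trans (Equiv.subRight (τ.symm 0)) := by
      refine perm_eq_of_lt_iff_lt fun x y => ?_
      have hxy := congrFun₂ hr x y
      simp only [cyclicOrder, eq_iff_iff] at hxy
      simp only [Equiv.trans_apply, Equiv.subRight_apply]
      by_cases hy : y = 0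
      · simp [hy]
      by_cases hx : x = 0
      · subst hx
        simp [Fin.pos_iff_ne_zero, sub_ne_zero, hy]
      · simpa [hx, hy] using hxy
    have : σ.symm = τ.symm := by
      ext x
      have := DFunLike.congr_fun heq x
      simp only [Equiv.trans_apply, Equiv.subRight_apply, h0] at this
      rw [sub_left_injective this]
    exact Equiv.symm_bijective.injective this
  · rintro ⟨k, r⟩ ⟨-, hr, hcv⟩
    have hl : ∀ {x y}, r x y → x ≠ 0 := fun h => by simpa using hr.left_mem h
    have hrm : ∀ {x y}, r x y → y ≠ 0 := fun h => by simpa using hr.right_mem h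
    have hr' : IsStrictOrderOn univ (fun x y => r x y ∨ (x = 0 ∧ y ≠ 0)) := by
      refine ⟨fun _ => mem_univ _, fun _ => mem_univ _, ?_, ?_, ?_⟩
      · rintro x (h | h)
        exacts [hr.irrefl x h, h.2 h.1]
      · rintro x y z (h | h) (h' | h')
        · exact Or.inl (hr.trans h h')
        · exact absurd h'.1 (hrm h)
        · exact Or.inr ⟨h.1, hrm h'⟩
        · exact absurd h'.1 h.2
      · intro x y _ _ hxy
        by_cases hx : x = 0
        · exact Or.inl (Or.inr ⟨hx, fun hy => hxy (hx.trans hy.symm)⟩)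
        by_cases hy : y = 0
        · exact Or.inr (Or.inr ⟨hy, hx⟩)
        · exact (hr.total (by simpa using hx) (by simpa using hy) hxy).imp Or.inl Or.inl
    obtain ⟨e, he⟩ := exists_perm_lt_iff hr'
    have he0 : e 0 = 0 := by
      by_contra h
      have hne : e.symm 0 ≠ 0 := fun h' => h (by rw [← h', e.apply_symm_apply, h'])
      have := (he 0 (e.symm 0)).2 (Or.inr ⟨rfl, hne⟩)
      rw [e.apply_symm_apply] at this
      exact Fin.not_lt_zero _ this
    have hcyc : cyclicOrder (e.trans (Equiv.addRight k)).symm = r := by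
      funext x y
      refine propext ?_
      simp only [cyclicOrder, Equiv.symm_symm, Equiv.trans_apply, Equiv.coe_addRight,
        he0, zero_add, add_sub_cancel_right, he]
      refine ⟨?_, fun h => ⟨hl h, hrm h, Or.inl h⟩⟩
      rintro ⟨hx, -, h | h⟩
      exacts [h, absurd h.1 hx]
    refine ⟨(e.trans (Equiv.addRight k)).symm, ?_, Prod.ext ?_ hcyc⟩
    · intro I hI
      rw [hcyc]
      exact hcv _ (mem_insert_of_mem (mem_image_of_mem _ hI))
    · simp [he0]

theorem IsChannel.isLaminar {C : Finset (Finset (Fin n))} (hC : IsChannel C) (hn : 3 ≤ n) :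
    IsLaminar {0}ᶜ (insert {0}ᶜ (C.image compl)) ∧
      (insert {0}ᶜ (C.image compl) : Finset (Finset (Fin n))).card = n - 2 := by
  obtain ⟨hcard, hsplit, hcomp⟩ := hC
  have hsub : ∀ I ∈ C, Iᶜ ⊆ ({0}ᶜ : Finset (Fin n)) := fun I hI =>
    compl_subset_compl.mpr (singleton_subset_iff.mpr (hsplit I hI).1)
  refine ⟨⟨?_, ?_, ?_⟩, ?_⟩
  · simp only [forall_mem_insert, forall_mem_image]
    exact ⟨subset_rfl, hsub⟩
  · simp only [forall_mem_insert, forall_mem_image, card_compl, Fintype.card_fin,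
      card_singleton]
    refine ⟨by omega, fun I hI => ?_⟩
    have := (hsplit I hI).2
    omega
  · simp only [forall_mem_insert, forall_mem_image]
    refine ⟨⟨Or.inl subset_rfl, fun I hI => Or.inr (Or.inl (hsub I hI))⟩,
      fun I hI => ⟨Or.inl (hsub I hI), fun J hJ => ?_⟩⟩
    rcases eq_or_ne I J with rfl | hne
    · exact Or.inl subset_rfl
    rcases hcomp I hI J hJ hne with h | h | h
    · exact Or.inr (Or.inl (compl_subset_compl.mpr h))
    · exact Or.inl (compl_subset_compl.mpr h)
    · refine Or.inr (Or.inr (disjoint_iff_inter_eq_empty.mpr ?_))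
      rw [← compl_union, h, compl_univ]
  · rw [card_insert_of_notMem, card_image_of_injective _ compl_injective, hcard]
    · omega
    · intro h
      obtain ⟨I, hI, h⟩ := mem_image.mp h
      have := (hsplit I hI).2.1
      rw [compl_injective h, card_singleton] at this
      omega

theorem actSet_arcOf_injOn (σ : Equiv.Perm (Fin n)) :
    Set.InjOn (fun d => actSet σ (arcOf d)) {d : Fin n × Fin n | IsDiagonal d} := by
  have hact : ∀ J K : Finset (Fin n), actSet σ J = actSet σ K → J = K ∨ J = Kᶜ := by
    intro J K h
    have hinj := image_injective σ.injective
    have hcompl : (K.image σ)ᶜ = Kᶜ.image σ := by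
      ext x
      simp [← Equiv.eq_symm_apply]
    simp only [actSet, normSet] at h
    split_ifs at h
    · exact Or.inl (hinj h)
    · exact Or.inr (hinj (h.trans hcompl))
    · exact Or.inr (hinj (by rw [← hcompl, ← h, compl_compl]))
    · exact Or.inl (hinj (compl_injective h))
  rintro ⟨i, j⟩ hd ⟨k, l⟩ he h
  have h1 := hd.1
  have h2 := he.1
  simp only at h1 h2
  rcases hact _ _ h with h | h
  · have hmem : ∀ x : Fin n, (i ≤ x ∧ x < j) ↔ (k ≤ x ∧ x < l) := fun x => by
      simpa only [mem_arcOf] using Finset.ext_iff.mp h x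
    have hi := hmem i
    have hk := hmem k
    have hj := hmem j
    have hl := hmem l
    simp only [Fin.le_def, Fin.lt_def] at hi hk hj hl
    refine Prod.ext (Fin.ext ?_) (Fin.ext ?_)
    · simp only
      omega
    · simp only
      omega
  · have hx := Finset.ext_iff.mp h ⟨n - 1, by have := NeZero.pos n; omega⟩
    have := j.isLt
    have := l.isLt
    simp only [mem_compl, mem_arcOf, Fin.le_def, Fin.lt_def] at hx
    omega

theorem not_compatible_actSet_of_cross (σ : Equiv.Perm (Fin n)) {d e : Fin n × Fin n}
    (h : Cross d e) : ¬ Compatible (actSet σ (arcOf d)) (actSet σ (arcOf e)) := by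
  have hmem : ∀ (J : Finset (Fin n)) (x : Fin n), σ x ∈ actSet σ J ↔ (x ∈ J ↔ σ.symm 0 ∈ J) := by
    intro J x
    have h0 : (0 : Fin n) ∈ J.image σ ↔ σ.symm 0 ∈ J := by simp [← Equiv.eq_symm_apply]
    have hx : σ x ∈ J.image σ ↔ x ∈ J := by simp
    rw [actSet, normSet]
    split_ifs with h
    · rw [hx]; tauto
    · rw [mem_compl, hx]; tauto
  have key : ∀ p q : Prop, ∃ x, (x ∈ arcOf d ↔ p) ∧ (x ∈ arcOf e ↔ q) := by
    obtain ⟨i, j⟩ := d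
    obtain ⟨k, l⟩ := e
    have hi : i.val < n := i.isLt
    have hj : j.val < n := j.isLt
    have hk : k.val < n := k.isLt
    have hl : l.val < n := l.isLt
    have hlast : n - 1 < n := by omega
    simp only [Cross, Fin.lt_def] at h
    simp only [mem_arcOf, Fin.le_def, Fin.lt_def]
    intro p q
    by_cases hp : p <;> by_cases hq : q <;> simp only [hp, hq, iff_true, iff_false]
    · rcases h with h | h
      exacts [⟨k, by omega⟩, ⟨i, by omega⟩]
    · rcases h with h | h
      exacts [⟨i, by omega⟩, ⟨l, by omega⟩]
    · rcases h with h | h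
      exacts [⟨j, by omega⟩, ⟨k, by omega⟩]
    · exact ⟨⟨n - 1, hlast⟩, by simp only; omega⟩
  rintro (h | h | h)
  · obtain ⟨x, hx, hy⟩ := key (σ.symm 0 ∈ arcOf d) (¬ σ.symm 0 ∈ arcOf e)
    have := @h (σ x)
    rw [hmem, hmem] at this
    tauto
  · obtain ⟨x, hx, hy⟩ := key (¬ σ.symm 0 ∈ arcOf d) (σ.symm 0 ∈ arcOf e)
    have := @h (σ x)
    rw [hmem, hmem] at this
    tauto
  · obtain ⟨x, hx, hy⟩ := key (¬ σ.symm 0 ∈ arcOf d) (¬ σ.symm 0 ∈ arcOf e)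
    have := h.ge (mem_univ (σ x))
    rw [mem_union, hmem, hmem] at this
    tauto

theorem IsChannel.bijOn_fst {C : Finset (Finset (Fin n))} (hC : IsChannel C) :
    Set.BijOn Prod.fst
      {p : Equiv.Perm (Fin n) × Finset (Fin n × Fin n) |
        IsTriangulation p.2 ∧ channelOf p.1 p.2 = C}
      {σ | ∀ I ∈ C, ∃ d, IsDiagonal d ∧ actSet σ (arcOf d) = I} := by
  classical
  refine ⟨?_, ?_, ?_⟩
  · rintro ⟨σ, T⟩ ⟨hT, hch⟩ I hI
    obtain ⟨d, hd, h⟩ := mem_image.mp (hch.ge hI)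
    exact ⟨d, hT.2.1 d hd, h⟩
  · rintro ⟨σ, T⟩ ⟨hT, hch⟩ ⟨τ, U⟩ ⟨hU, hch'⟩ (rfl : σ = τ)
    refine Prod.ext rfl (coe_injective ?_)
    refine ((actSet_arcOf_injOn σ).image_eq_image_iff hT.2.1 hU.2.1).mp ?_
    have := hch.trans hch'.symm
    simpa only [channelOf, ← coe_inj, coe_image] using this
  · intro σ hσ
    have hinj := actSet_arcOf_injOn σ
    let T : Finset (Fin n × Fin n) :=
      univ.filter fun d => IsDiagonal d ∧ actSet σ (arcOf d) ∈ C
    have hT : ∀ d, d ∈ T ↔ IsDiagonal d ∧ actSet σ (arcOf d) ∈ C := by simp [T]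
    have hch : channelOf σ T = C := by
      ext I
      simp only [channelOf, mem_image, hT]
      constructor
      · rintro ⟨d, hd, rfl⟩
        exact hd.2
      · intro hI
        obtain ⟨d, hd, rfl⟩ := hσ I hI
        exact ⟨d, ⟨hd, hI⟩, rfl⟩
    refine ⟨(σ, T), ⟨⟨?_, fun d hd => ((hT d).1 hd).1, ?_⟩, hch⟩, rfl⟩
    · rw [← hC.1, ← hch, channelOf,
        card_image_of_injOn (hinj.mono fun d hd => ((hT d).1 hd).1)]
    · intro d hd e he hne hcross
      have hd' := (hT d).1 hd
      have he' := (hT e).1 he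
      exact not_compatible_actSet_of_cross σ hcross
        (hC.2.2 _ hd'.2 _ he'.2 fun h => hne (hinj hd'.1 he'.1 h))

end Polygon

/-- Key counting claim of Section 2: for every scattering channel `C`, the number of pairs
`(σ, T)` of a permutation and a triangulation with `ch(σ, T) = C` is exactly `n · 2^{n-2}`. -/
theorem card_pairs_mapping_to_channel (n : ℕ) [NeZero n] (hn : 3 ≤ n)
    (C : Finset (Finset (Fin n))) (hC : IsChannel C) :
    { p : Equiv.Perm (Fin n) × Finset (Fin n × Fin n) |
        IsTriangulation p.2 ∧ channelOf p.1 p.2 = C }.ncard = n * 2 ^ (n - 2) := by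
  have hset : {σ : Equiv.Perm (Fin n) | ∀ I ∈ C, ∃ d, IsDiagonal d ∧ actSet σ (arcOf d) = I} =
      {σ | ∀ I ∈ C, IsConvexFor (cyclicOrder σ) Iᶜ} := by
    ext σ
    exact forall₂_congr fun I hI => exists_actSet_arcOf_eq_iff σ (hC.2.1 I hI)
  obtain ⟨hlam, hcard⟩ := hC.isLaminar hn
  have hbij := bijOn_cyclicOrder C
  rw [← hC.bijOn_fst.injOn.ncard_image, hC.bijOn_fst.image_eq, hset,
    ← hbij.injOn.ncard_image, hbij.image_eq, Set.ncard_prod, Set.ncard_univ,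
    Nat.card_eq_fintype_card, Fintype.card_fin, hlam.ncard_convexOrders, hcard]
  rw [hcard, Finset.card_compl, Fintype.card_fin, Finset.card_singleton]
  omega
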